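/- arXiv:2509.19702 — 2 statements merged into one kernel-verified Lean document; each statement's English description precedes it below -/
import Mathlib

section
/- Let λ̄ ≥ λ̲ > 0, θ = λ̄/λ̲ - 1, and suppose the step is exactly ηλ̄ = 1/3. Then under λ̄_+ = (1 - ηλ̄)^2 λ̄, λ̲_+ = (1 - ηλ̲)^2 λ̲, the new gap θ_+ = λ̄_+/λ̲_+ - 1 satisfies θ_+ = θ^2 (4θ + 3)/(3θ + 2)^2 ≤ (3/4) θ^2. -/
/-- Quadratic (Newton–Schulz) contraction phase: with `λ̄ ≥ λ̲ > 0`,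
`θ = λ̄/λ̲ - 1`, and step exactly `η λ̄ = 1/3`, the updated excess
`θ₊ = λ̄₊/λ̲₊ - 1` (where `λ̄₊ = (1-ηλ̄)²λ̄`, `λ̲₊ = (1-ηλ̲)²λ̲`) equals
`θ² (4θ+3)/(3θ+2)²` and is at most `(3/4) θ²`. -/
theorem eagle_quadratic_contraction
    (lamHi lamLo η : ℝ)
    (hlo : 0 < lamLo) (hle : lamLo ≤ lamHi)
    (hη : η * lamHi = 1 / 3) :
    ((1 - η * lamHi) ^ 2 * lamHi) / ((1 - η * lamLo) ^ 2 * lamLo) - 1 =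
      (lamHi / lamLo - 1) ^ 2 * (4 * (lamHi / lamLo - 1) + 3) /
        (3 * (lamHi / lamLo - 1) + 2) ^ 2 ∧
    ((1 - η * lamHi) ^ 2 * lamHi) / ((1 - η * lamLo) ^ 2 * lamLo) - 1 ≤
      3 / 4 * (lamHi / lamLo - 1) ^ 2 := by
  obtain ⟨t, ht⟩ : ∃ t, t = lamHi / lamLo - 1 := ⟨_, rfl⟩
  have hHi : lamHi = (t + 1) * lamLo := by
    rw [ht]; field_simp; ring
  have ht0 : 0 ≤ t := by
    rw [ht, sub_nonneg, le_div_iff₀ hlo]; linarith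
  have h1 : 0 < t + 1 := by linarith
  have h2 : 0 < 3 * t + 2 := by linarith
  have hL : 1 - η * lamLo = (3 * t + 2) / (3 * (t + 1)) := by
    rw [hHi] at hη
    rw [eq_div_iff (by positivity)]
    linear_combination (-3) * hη
  have key : ((1 - η * lamHi) ^ 2 * lamHi) / ((1 - η * lamLo) ^ 2 * lamLo) - 1 =
      t ^ 2 * (4 * t + 3) / (3 * t + 2) ^ 2 := by
    rw [hη, hL, hHi]
    field_simp
    ring
  rw [key, ← ht]
  refine ⟨rfl, ?_⟩
  rw [div_le_iff₀ (by positivity)]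
  have h3 : 0 ≤ t ^ 2 * (27 * t ^ 2 + 20 * t) := by positivity
  linarith [h3, show 3 / 4 * t ^ 2 * (3 * t + 2) ^ 2 - t ^ 2 * (4 * t + 3)
    = 1 / 4 * (t ^ 2 * (27 * t ^ 2 + 20 * t)) by ring]
end

section
/- For the centralized EAGLE algorithm with η = 1/3 and γ = 1 (i.e., η_ℓ = 1/(3λ̄_ℓ), γ_ℓ = 1/λ̄_ℓ), for any ε > 0 the Frobenius-norm error to the Nyström estimate satisfies ‖D_L - D̂_*‖_F ≤ ε for all L ≥ O(log κ(A) + log log(ε^{-1} √(d') ‖W_*‖_2 ‖C‖_F)), where D̂_* = W_* C and W_* = B A^⊤ (A A^⊤)^†. -/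
open Matrix

/-- The spectral (ℓ₂ operator) norm of a real matrix. -/
noncomputable def specNorm {m n : ℕ} (M : Matrix (Fin m) (Fin n) ℝ) : ℝ :=
  ‖LinearMap.toContinuousLinearMap (Matrix.toEuclideanLin M)‖

/-- The Frobenius norm of a real matrix. -/
noncomputable def frobNorm {m n : ℕ} (M : Matrix (Fin m) (Fin n) ℝ) : ℝ :=
  Real.sqrt (∑ i, ∑ j, (M i j) ^ 2)

open scoped Matrix.Norms.L2Operator in
theorem specNorm_eq {m n : ℕ} (M : Matrix (Fin m) (Fin n) ℝ) : specNorm M = ‖M‖ := by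
  rw [Matrix.l2_opNorm_def]; rfl

theorem specNorm_nonneg {m n : ℕ} (M : Matrix (Fin m) (Fin n) ℝ) : 0 ≤ specNorm M := norm_nonneg _

open scoped Matrix.Norms.L2Operator in
theorem specNorm_sq {m n : ℕ} (M : Matrix (Fin m) (Fin n) ℝ) :
    specNorm M ^ 2 = specNorm (M * Mᵀ) := by
  have h := Matrix.l2_opNorm_conjTranspose_mul_self Mᴴ
  rw [Matrix.l2_opNorm_conjTranspose, conjTranspose_conjTranspose] at h
  rw [specNorm_eq, specNorm_eq, sq, ← h, conjTranspose_eq_transpose_of_trivial]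

open scoped Matrix.Norms.L2Operator in
theorem specNorm_conj {d : ℕ} (U : Matrix (Fin d) (Fin d) ℝ) (h : Uᵀ * U = 1) (h' : U * Uᵀ = 1)
    (v : Fin d → ℝ) : specNorm (U * diagonal v * Uᵀ) = ‖v‖ := by
  have hU : U ∈ unitary (Matrix (Fin d) (Fin d) ℝ) := by
    rw [Unitary.mem_iff, star_eq_conjTranspose, conjTranspose_eq_transpose_of_trivial]
    exact ⟨h, h'⟩
  have hU' : Uᵀ ∈ unitary (Matrix (Fin d) (Fin d) ℝ) := by
    rw [Unitary.mem_iff, star_eq_conjTranspose, conjTranspose_eq_transpose_of_trivial]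
    simpa using ⟨h', h⟩
  rw [specNorm_eq, CStarRing.norm_mul_mem_unitary _ hU', CStarRing.norm_mem_unitary_mul _ hU,
    Matrix.l2_opNorm_diagonal]

theorem frobNorm_nonneg {m n : ℕ} (M : Matrix (Fin m) (Fin n) ℝ) : 0 ≤ frobNorm M :=
  Real.sqrt_nonneg _

theorem frobNorm_neg {m n : ℕ} (M : Matrix (Fin m) (Fin n) ℝ) : frobNorm (-M) = frobNorm M := by
  simp [frobNorm]

open scoped Matrix.Norms.L2Operator in
theorem frobNorm_mul_le {m n k : ℕ} (M : Matrix (Fin m) (Fin n) ℝ) (X : Matrix (Fin n) (Fin k) ℝ) :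
    frobNorm (M * X) ≤ specNorm M * frobNorm X := by
  have key : ∀ j, ∑ i, (M * X) i j ^ 2 ≤ specNorm M ^ 2 * ∑ i, X i j ^ 2 := by
    intro j
    have h := Matrix.l2_opNorm_mulVec M (WithLp.toLp 2 (fun i => X i j))
    rw [← specNorm_eq] at h
    have h2 := pow_le_pow_left₀ (norm_nonneg _) h 2
    rw [mul_pow, EuclideanSpace.norm_sq_eq, EuclideanSpace.norm_sq_eq] at h2
    simpa [Matrix.mul_apply, Matrix.mulVec, dotProduct] using h2
  unfold frobNorm
  rw [Finset.sum_comm, Finset.sum_comm (f := fun i j => X i j ^ 2)]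
  refine Real.sqrt_le_iff.mpr ⟨mul_nonneg (specNorm_nonneg M) (Real.sqrt_nonneg _), ?_⟩
  rw [mul_pow, Real.sq_sqrt (by positivity), Finset.mul_sum]
  exact Finset.sum_le_sum fun j _ => key j

theorem exists_diag {d : ℕ} (E : Matrix (Fin d) (Fin d) ℝ) (hE : E.PosDef) :
    ∃ (U : Matrix (Fin d) (Fin d) ℝ) (v : Fin d → ℝ), Uᵀ * U = 1 ∧ U * Uᵀ = 1 ∧ (∀ i, 0 < v i) ∧
      E = U * diagonal v * Uᵀ := by
  have hU := hE.isHermitian.eigenvectorUnitary.2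
  have hst := hE.isHermitian.spectral_theorem
  rw [Unitary.mem_iff, star_eq_conjTranspose, conjTranspose_eq_transpose_of_trivial] at hU
  refine ⟨hE.isHermitian.eigenvectorUnitary, hE.isHermitian.eigenvalues, hU.1, hU.2,
    hE.eigenvalues_pos, ?_⟩
  rw [Unitary.conjStarAlgAut_apply, star_eq_conjTranspose,
    conjTranspose_eq_transpose_of_trivial] at hst
  exact hst

theorem conj_diag_mul {d : ℕ} (U : Matrix (Fin d) (Fin d) ℝ) (h : Uᵀ * U = 1) (v w : Fin d → ℝ) :
    (U * diagonal v * Uᵀ) * (U * diagonal w * Uᵀ) = U * diagonal (fun i => v i * w i) * Uᵀ := by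
  calc _ = U * diagonal v * (Uᵀ * U) * diagonal w * Uᵀ := by simp only [Matrix.mul_assoc]
    _ = _ := by rw [h, Matrix.mul_one, Matrix.mul_assoc U, diagonal_mul_diagonal]

theorem one_sub_conj {d : ℕ} (U : Matrix (Fin d) (Fin d) ℝ) (h' : U * Uᵀ = 1) (a : ℝ)
    (v : Fin d → ℝ) :
    1 - a • (U * diagonal v * Uᵀ) = U * diagonal (fun i => 1 - a * v i) * Uᵀ := by
  have : diagonal (fun i => 1 - a * v i) = (1 : Matrix (Fin d) (Fin d) ℝ) - a • diagonal v := by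
    ext i j
    by_cases hij : i = j
    · subst hij; simp
    · simp [hij]
  rw [this, Matrix.mul_sub, Matrix.sub_mul, Matrix.mul_one, h', Matrix.mul_smul, Matrix.smul_mul]

theorem norm_eq_of_max {d : ℕ} (v : Fin d → ℝ) (i0 : Fin d) (h : ∀ i, 0 < v i ∧ v i ≤ v i0) :
    ‖v‖ = v i0 := by
  apply le_antisymm
  · refine (pi_norm_le_iff_of_nonneg (h i0).1.le).2 fun i => ?_
    rw [Real.norm_eq_abs, abs_of_pos (h i).1]; exact (h i).2
  · exact (le_abs_self _).trans (norm_le_pi_norm v i0)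

theorem gram_step {d n : ℕ} (A : Matrix (Fin d) (Fin n) ℝ) (a : ℝ) :
    (A * (1 - a • (Aᵀ * A))) * (A * (1 - a • (Aᵀ * A)))ᵀ
      = (A * Aᵀ) * ((1 - a • (A * Aᵀ)) * (1 - a • (A * Aᵀ))) := by
  simp only [transpose_mul, transpose_sub, transpose_one, transpose_smul, transpose_transpose,
    Matrix.mul_sub, Matrix.sub_mul, Matrix.mul_one, Matrix.one_mul, Matrix.mul_smul,
    Matrix.smul_mul, Matrix.mul_assoc]

theorem resid_step {d d' n : ℕ} (A : Matrix (Fin d) (Fin n) ℝ) (R : Matrix (Fin d') (Fin n) ℝ)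
    (a : ℝ) (h : R * Aᵀ = 0) :
    (R * (1 - a • (Aᵀ * A))) * (A * (1 - a • (Aᵀ * A)))ᵀ = 0 := by
  have : (R * (1 - a • (Aᵀ * A))) * (A * (1 - a • (Aᵀ * A)))ᵀ
      = (R * Aᵀ) * ((1 - a • (A * Aᵀ)) * (1 - a • (A * Aᵀ))) := by
    simp only [transpose_mul, transpose_sub, transpose_one, transpose_smul, transpose_transpose,
      Matrix.mul_sub, Matrix.sub_mul, Matrix.mul_one, Matrix.one_mul, Matrix.mul_smul,
      Matrix.smul_mul, Matrix.mul_assoc]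
  rw [this, h, Matrix.zero_mul]

/-- Scalar step: the relative gap is at least squared. -/
theorem scalar_step (x m : ℝ) (hx : 0 < x) (hxm : x ≤ m) :
    0 < x * ((1 - 1 / (3 * m) * x) * (1 - 1 / (3 * m) * x)) ∧
    x * ((1 - 1 / (3 * m) * x) * (1 - 1 / (3 * m) * x))
      ≤ m * ((1 - 1 / (3 * m) * m) * (1 - 1 / (3 * m) * m)) ∧
    1 - (x * ((1 - 1 / (3 * m) * x) * (1 - 1 / (3 * m) * x)))
      / (m * ((1 - 1 / (3 * m) * m) * (1 - 1 / (3 * m) * m))) ≤ (1 - x / m) ^ 2 := by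
  have hm : 0 < m := hx.trans_le hxm
  obtain ⟨y, rfl⟩ : ∃ y, x = y * m := ⟨x / m, by field_simp⟩
  have hy : 0 < y := by
    by_contra hc
    exact absurd hx (not_lt.2 (mul_nonpos_of_nonpos_of_nonneg (not_lt.1 hc) hm.le))
  have hy1 : y ≤ 1 := by
    by_contra hc
    nlinarith [not_le.1 hc]
  have e1 : 1 - 1 / (3 * m) * (y * m) = 1 - y / 3 := by field_simp
  have e2 : 1 - 1 / (3 * m) * m = 2 / 3 := by field_simp; norm_num
  rw [e1, e2]
  have hp : 0 < 1 - y / 3 := by linarith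
  refine ⟨by positivity, ?_, ?_⟩
  · have : y * ((1 - y / 3) * (1 - y / 3)) ≤ 4 / 9 := by
      nlinarith [mul_nonneg (sq_nonneg (1 - y)) (by linarith : (0:ℝ) ≤ 4 - y)]
    nlinarith
  · have e3 : y * m * ((1 - y / 3) * (1 - y / 3)) / (m * (2 / 3 * (2 / 3)))
        = y * (3 - y) ^ 2 / 4 := by field_simp; ring
    have e4 : y * m / m = y := by field_simp
    rw [e3, e4]
    nlinarith [mul_nonneg (sq_nonneg (1 - y)) hy.le]

theorem log_count (κ Y : ℝ) (hκ : 1 ≤ κ) :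
    ∃ L : ℕ, (L : ℝ) ≤ 2 * (1 + Real.log κ + Real.log (max 2 Y)) ∧
      ∀ ℓ, L ≤ ℓ → κ * Y ≤ ((2 ^ ℓ - 1 : ℕ) : ℝ) := by
  set Z := max 2 Y
  have hZ : 2 ≤ Z := le_max_left _ _
  have hK : 2 ≤ κ * Z := by nlinarith
  have hlog : 0 ≤ Real.log (κ * Z) := Real.log_nonneg (by linarith)
  have hl2 : (1:ℝ) / 2 ≤ Real.log 2 := by have := Real.log_two_gt_d9; linarith
  have h0 : 0 ≤ Real.log (κ * Z) / Real.log 2 := by positivity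
  refine ⟨⌈Real.log (κ * Z) / Real.log 2⌉₊ + 1, ?_, ?_⟩
  · have h1 := Nat.ceil_lt_add_one h0
    have h2 : Real.log (κ * Z) / Real.log 2 ≤ 2 * Real.log (κ * Z) := by
      rw [div_le_iff₀ (by linarith)]; nlinarith
    rw [Real.log_mul (by linarith) (by linarith)] at *
    push_cast
    linarith
  · intro ℓ hℓ
    have h1 : Real.log (κ * Z) / Real.log 2 + 1 ≤ ℓ := by
      have := Nat.le_ceil (Real.log (κ * Z) / Real.log 2)
      have h3 : ((⌈Real.log (κ * Z) / Real.log 2⌉₊ + 1 : ℕ) : ℝ) ≤ ℓ := by exact_mod_cast hℓ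
      push_cast at h3
      linarith
    have h2 : Real.log (κ * Z * 2) ≤ Real.log ((2:ℝ) ^ ℓ) := by
      rw [Real.log_mul (by linarith) (by norm_num), Real.log_pow]
      have : Real.log (κ * Z) = Real.log (κ * Z) / Real.log 2 * Real.log 2 := by field_simp
      nlinarith
    have h3 := (Real.log_le_log_iff (by linarith) (by positivity)).1 h2
    rw [Nat.cast_sub Nat.one_le_two_pow]
    push_cast
    have : κ * Y ≤ κ * Z := mul_le_mul_of_nonneg_left (le_max_right _ _) (by linarith)
    linarith

theorem decay (κ X : ℝ) (hκ : 1 ≤ κ) (hX : 0 < X) (N : ℕ) (h : κ * Real.log X ≤ N) :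
    X * (1 - 1 / κ) ^ N ≤ 1 := by
  have h0 : 0 ≤ 1 - 1 / κ := by
    rw [sub_nonneg, div_le_one (by linarith)]; exact hκ
  have h1 : 1 - 1 / κ ≤ Real.exp (-(1 / κ)) := by
    have := Real.add_one_le_exp (-(1 / κ)); linarith
  have h2 : (1 - 1 / κ) ^ N ≤ Real.exp (-(N / κ)) := by
    refine (pow_le_pow_left₀ h0 h1 N).trans_eq ?_
    rw [← Real.exp_nat_mul]; congr 1; ring
  have h3 : Real.log X ≤ N / κ := by
    rw [le_div_iff₀ (by linarith)]; linarith
  calc X * (1 - 1 / κ) ^ N ≤ Real.exp (Real.log X) * Real.exp (-(N / κ)) := by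
        rw [Real.exp_log hX]; exact mul_le_mul_of_nonneg_left h2 hX.le
    _ = Real.exp (Real.log X - N / κ) := by rw [← Real.exp_add]; congr 1
    _ ≤ 1 := Real.exp_le_one_iff.2 (by linarith)

/-- Second-order convergence of centralized EAGLE (Theorem 1). With steps
`η_ℓ = 1/(3‖A_ℓ‖₂²)` and `γ_ℓ = 1/‖A_ℓ‖₂²`, for every `ε > 0` there is an
iteration count `L = O(log κ + log log(ε⁻¹ √d' ‖W⋆‖₂ ‖C‖_F))` — where
`κ` is the condition number of `A Aᵀ` and `W⋆ = B Aᵀ (A Aᵀ)⁻¹` is the Nyström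
parameter (`A` has full row rank) — such that `‖D_ℓ - D̂⋆‖_F ≤ ε` for all
`ℓ ≥ L`, with `D̂⋆ = W⋆ C` the Nyström estimate. -/
theorem eagle_centralized_second_order_convergence :
    ∃ c : ℝ, 0 < c ∧
    ∀ (d d' n : ℕ)
      (A : Matrix (Fin d) (Fin n) ℝ) (B : Matrix (Fin d') (Fin n) ℝ)
      (C : Matrix (Fin d) (Fin d') ℝ),
      (A * Aᵀ).PosDef →
      ∀ (Aseq : ℕ → Matrix (Fin d) (Fin n) ℝ)
        (Bseq : ℕ → Matrix (Fin d') (Fin n) ℝ)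
        (Cseq : ℕ → Matrix (Fin d) (Fin d') ℝ)
        (Dseq : ℕ → Matrix (Fin d') (Fin d') ℝ)
        (η γ : ℕ → ℝ),
        (∀ ℓ, η ℓ = 1 / (3 * specNorm (Aseq ℓ) ^ 2)) →
        (∀ ℓ, γ ℓ = 1 / specNorm (Aseq ℓ) ^ 2) →
        Aseq 0 = A → Bseq 0 = B → Cseq 0 = C → Dseq 0 = 0 →
        (∀ ℓ, Aseq (ℓ + 1) = Aseq ℓ * (1 - η ℓ • ((Aseq ℓ)ᵀ * Aseq ℓ))) →
        (∀ ℓ, Bseq (ℓ + 1) = Bseq ℓ * (1 - η ℓ • ((Aseq ℓ)ᵀ * Aseq ℓ))) →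
        (∀ ℓ, Cseq (ℓ + 1) = (1 - γ ℓ • (Aseq ℓ * (Aseq ℓ)ᵀ)) * Cseq ℓ) →
        (∀ ℓ, Dseq (ℓ + 1) = Dseq ℓ + γ ℓ • (Bseq ℓ * (Aseq ℓ)ᵀ * Cseq ℓ)) →
        ∀ ε : ℝ, 0 < ε →
        ∃ L : ℕ,
          (L : ℝ) ≤ c * (1 + Real.log (specNorm (A * Aᵀ) * specNorm ((A * Aᵀ)⁻¹))
            + Real.log (max 2 (Real.log (max 2
              (ε⁻¹ * Real.sqrt d' * specNorm (B * Aᵀ * (A * Aᵀ)⁻¹) * frobNorm C))))) ∧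
          ∀ ℓ, L ≤ ℓ → frobNorm (Dseq ℓ - B * Aᵀ * (A * Aᵀ)⁻¹ * C) ≤ ε := by
  refine ⟨2, by norm_num, ?_⟩
  intro d d' n A B C hpd Aseq Bseq Cseq Dseq η γ hη hγ hA0 hB0 hC0 hD0 hA hB hC hD ε hε
  set W := B * Aᵀ * (A * Aᵀ)⁻¹ with hW
  have hdet : IsUnit (A * Aᵀ).det := hpd.det_pos.ne'.isUnit
  -- algebraic invariants
  have hR : ∀ ℓ, (Bseq ℓ - W * Aseq ℓ) * (Aseq ℓ)ᵀ = 0 := by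
    intro ℓ
    induction ℓ with
    | zero =>
      rw [hA0, hB0, Matrix.sub_mul, Matrix.mul_assoc W, hW,
        Matrix.nonsing_inv_mul_cancel_right _ _ hdet, sub_self]
    | succ k ih =>
      rw [hB, hA, ← Matrix.mul_assoc W, ← Matrix.sub_mul]
      exact resid_step _ _ _ ih
  have hinv : ∀ ℓ, Dseq ℓ + W * Cseq ℓ = W * C := by
    intro ℓ
    induction ℓ with
    | zero => rw [hD0, hC0, zero_add]
    | succ k ih =>
      have h1 : Bseq k * (Aseq k)ᵀ = W * (Aseq k * (Aseq k)ᵀ) := by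
        have := hR k
        rw [Matrix.sub_mul, Matrix.mul_assoc W] at this
        exact sub_eq_zero.1 this
      rw [hD, hC, h1, ← ih, Matrix.sub_mul, Matrix.mul_sub, Matrix.one_mul, Matrix.smul_mul,
        Matrix.mul_smul, Matrix.mul_assoc]
      abel
  have herr : ∀ ℓ, frobNorm (Dseq ℓ - W * C) = frobNorm (W * Cseq ℓ) := by
    intro ℓ
    rw [← hinv ℓ, ← frobNorm_neg]
    congr 1
    abel
  set X := ε⁻¹ * Real.sqrt d' * specNorm W * frobNorm C with hX
  set κ := specNorm (A * Aᵀ) * specNorm ((A * Aᵀ)⁻¹) with hκdef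
  rcases Nat.eq_zero_or_pos d with hd | hd
  · subst hd
    have hk0 : κ = 0 := by
      have : A * Aᵀ = 0 := Subsingleton.elim _ _
      rw [hκdef, this]
      simp [specNorm]
    refine ⟨0, ?_, ?_⟩
    · rw [hk0, Real.log_zero]
      have : 0 ≤ Real.log (max 2 (Real.log (max 2 X))) :=
        Real.log_nonneg (le_trans (by norm_num) (le_max_left _ _))
      push_cast
      linarith
    · intro ℓ _
      rw [herr]
      have : W * Cseq ℓ = 0 := by
        ext i j
        simp [Matrix.mul_apply]
      rw [this]
      simpa [frobNorm] using hε.le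
  obtain ⟨U, v0, hU, hU', hv0, hE0⟩ := exists_diag _ hpd
  have : Nonempty (Fin d) := ⟨⟨0, hd⟩⟩
  obtain ⟨i0, hi0⟩ := Finite.exists_max v0
  have hEinv : (A * Aᵀ)⁻¹ = U * diagonal (fun i => (v0 i)⁻¹) * Uᵀ := by
    apply Matrix.inv_eq_right_inv
    rw [hE0, conj_diag_mul U hU]
    have : (fun i => v0 i * (v0 i)⁻¹) = fun _ => (1:ℝ) := by
      funext i; exact mul_inv_cancel₀ (hv0 i).ne'
    rw [this, diagonal_one, Matrix.mul_one, hU']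
  have hκ_ge : ∀ i, v0 i0 / v0 i ≤ κ := by
    intro i
    rw [hκdef, hEinv, hE0, specNorm_conj U hU hU', specNorm_conj U hU hU',
      norm_eq_of_max v0 i0 fun i => ⟨hv0 i, hi0 i⟩, div_eq_mul_inv]
    refine mul_le_mul_of_nonneg_left ?_ (hv0 i0).le
    exact (le_abs_self _).trans (norm_le_pi_norm (fun i => (v0 i)⁻¹) i)
  have hκ1 : 1 ≤ κ := by
    have := hκ_ge i0
    rwa [div_self (hv0 i0).ne'] at this
  have hq0 : 0 ≤ 1 - 1 / κ := by
    rw [sub_nonneg, div_le_one (by linarith)]; exact hκ1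
  -- spectral invariant
  have hspec : ∀ ℓ, ∃ v p : Fin d → ℝ, (∀ i, 0 < v i ∧ v i ≤ v i0) ∧
      (∀ i, 1 - v i / v i0 ≤ (1 - 1 / κ) ^ (2 ^ ℓ)) ∧
      Aseq ℓ * (Aseq ℓ)ᵀ = U * diagonal v * Uᵀ ∧
      Cseq ℓ = U * diagonal p * Uᵀ * C ∧ ∀ i, |p i| ≤ (1 - 1 / κ) ^ (2 ^ ℓ - 1) := by
    intro ℓ
    induction ℓ with
    | zero =>
      refine ⟨v0, fun _ => 1, fun i => ⟨hv0 i, hi0 i⟩, ?_, by rw [hA0, hE0], ?_, ?_⟩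
      · intro i
        have h1 : 1 / κ ≤ v0 i / v0 i0 := by
          rw [← one_div_div (v0 i0) (v0 i)]
          exact one_div_le_one_div_of_le (div_pos (hv0 i0) (hv0 i)) (hκ_ge i)
        simp only [pow_zero, pow_one]
        linarith
      · rw [diagonal_one, Matrix.mul_one, hU', Matrix.one_mul, hC0]
      · intro i; simp
    | succ k ih =>
      obtain ⟨v, p, hv, hgap, hE, hCk, hp⟩ := ih
      have hs : specNorm (Aseq k) ^ 2 = v i0 := by
        rw [specNorm_sq, hE, specNorm_conj U hU hU', norm_eq_of_max v i0 hv]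
      have hηk : η k = 1 / (3 * v i0) := by rw [hη, hs]
      have hγk : γ k = 1 / v i0 := by rw [hγ, hs]
      refine ⟨fun i => v i * ((1 - 1 / (3 * v i0) * v i) * (1 - 1 / (3 * v i0) * v i)),
        fun i => (1 - 1 / v i0 * v i) * p i, ?_, ?_, ?_, ?_, ?_⟩
      · intro i
        have := scalar_step (v i) (v i0) (hv i).1 (hv i).2
        exact ⟨this.1, this.2.1⟩
      · intro i
        have h1 := (scalar_step (v i) (v i0) (hv i).1 (hv i).2).2.2
        refine h1.trans ?_
        rw [pow_succ 2 k, pow_mul]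
        refine pow_le_pow_left₀ ?_ (hgap i) 2
        rw [sub_nonneg, div_le_one (hv i0).1]
        exact (hv i).2
      · rw [hA, gram_step, hE, hηk, one_sub_conj U hU', conj_diag_mul U hU, conj_diag_mul U hU]
      · rw [hC, hE, hγk, one_sub_conj U hU', hCk, ← Matrix.mul_assoc, conj_diag_mul U hU]
      · intro i
        have h0 : 0 ≤ 1 - v i / v i0 := by
          rw [sub_nonneg, div_le_one (hv i0).1]
          exact (hv i).2
        have h1 : 1 - 1 / v i0 * v i = 1 - v i / v i0 := by ring
        have h2 : 2 ^ (k + 1) - 1 = 2 ^ k + (2 ^ k - 1) := by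
          have := Nat.one_le_two_pow (n := k)
          rw [pow_succ]; omega
        show |(1 - 1 / v i0 * v i) * p i| ≤ _
        rw [h1, abs_mul, abs_of_nonneg h0, h2, pow_add]
        exact mul_le_mul (hgap i) (hp i) (abs_nonneg _) (pow_nonneg hq0 _)
  obtain ⟨L, hL, hL'⟩ := log_count κ (Real.log (max 2 X)) hκ1
  refine ⟨L, hL, fun ℓ hℓ => ?_⟩
  obtain ⟨v, p, -, -, -, hCl, hp⟩ := hspec ℓ
  have hdec := decay κ (max 2 X) hκ1 (lt_of_lt_of_le (by norm_num) (le_max_left _ _)) _ (hL' ℓ hℓ)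
  set q := (1 - 1 / κ) ^ (2 ^ ℓ - 1) with hq
  have hqn : 0 ≤ q := pow_nonneg hq0 _
  have hM : ε⁻¹ * (specNorm W * frobNorm C) ≤ X := by
    rcases Nat.eq_zero_or_pos d' with h | h
    · have : frobNorm C = 0 := by
        subst h
        simp [frobNorm]
      rw [hX, this]; simp
    · have h1 : 1 ≤ Real.sqrt d' := Real.one_le_sqrt.2 (by exact_mod_cast h)
      have h2 : 0 ≤ ε⁻¹ * (specNorm W * frobNorm C) :=
        mul_nonneg (inv_nonneg.2 hε.le) (mul_nonneg (specNorm_nonneg _) (frobNorm_nonneg _))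
      calc ε⁻¹ * (specNorm W * frobNorm C)
          ≤ Real.sqrt d' * (ε⁻¹ * (specNorm W * frobNorm C)) := le_mul_of_one_le_left h2 h1
        _ = X := by rw [hX]; ring
  have hfin : ε⁻¹ * (specNorm W * frobNorm C) * q ≤ 1 :=
    (mul_le_mul_of_nonneg_right (hM.trans (le_max_right _ _)) hqn).trans hdec
  rw [herr]
  have hCq : frobNorm (Cseq ℓ) ≤ q * frobNorm C := by
    rw [hCl]
    refine (frobNorm_mul_le _ _).trans (mul_le_mul_of_nonneg_right ?_ (frobNorm_nonneg _))
    rw [specNorm_conj U hU hU']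
    exact (pi_norm_le_iff_of_nonneg hqn).2 hp
  calc frobNorm (W * Cseq ℓ) ≤ specNorm W * frobNorm (Cseq ℓ) := frobNorm_mul_le _ _
    _ ≤ specNorm W * (q * frobNorm C) := mul_le_mul_of_nonneg_left hCq (specNorm_nonneg _)
    _ = ε * (ε⁻¹ * (specNorm W * frobNorm C) * q) := by field_simp
    _ ≤ ε * 1 := mul_le_mul_of_nonneg_left hfin hε.le
    _ = ε := mul_one _
end
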